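/- arXiv:math/0306430 — 2 statements merged into one kernel-verified Lean document; each statement's English description precedes it below -/
import Mathlib

section
/- Let φ : ℝ^d → ℝ, let S ⊆ ℝ^d, and let C > 0. Suppose that for every x ∈ S, φ is differentiable at x and satisfies the two-sided tangency estimate |φ(z) − φ(x) − ⟨∇φ(x), z − x⟩| ≤ C |z − x|² log(1/|z − x|) for all z with 0 < |z − x| ≤ 1/2. Then there exists a constant C', depending only on C, such that for all x, y ∈ S with 0 < |x − y| ≤ 1/2, |∇φ(x) − ∇φ(y)| ≤ C' |x − y| log(1/|x − y|). -/
noncomputable section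

local notation "⟪" x ", " y "⟫" => @inner ℝ _ _ x y

/-- `s ↦ s² log (1/s)` is monotone on `(0, 1/2]`. -/
theorem sq_mul_log_one_div_le {s r : ℝ} (hs : 0 < s) (hsr : s ≤ r) (hr : r ≤ 1 / 2) :
    s ^ 2 * Real.log (1 / s) ≤ r ^ 2 * Real.log (1 / r) := by
  have hr0 : 0 < r := hs.trans_le hsr
  have hL : 1 / 2 ≤ Real.log (1 / r) := by
    have h2 : Real.log 2 ≤ Real.log (1 / r) :=
      Real.log_le_log two_pos ((le_div_iff₀ hr0).2 (by linarith))
    linarith [Real.log_two_gt_d9]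
  have hlog := Real.log_le_sub_one_of_pos (x := (r / s) ^ 2) (by positivity)
  rw [Real.log_pow, Real.log_div hr0.ne' hs.ne', div_pow] at hlog
  push_cast at hlog
  have hmul := mul_le_mul_of_nonneg_left hlog (sq_nonneg s)
  have hcancel : s ^ 2 * (r ^ 2 / s ^ 2 - 1) = r ^ 2 - s ^ 2 := by field_simp
  rw [hcancel] at hmul
  simp only [one_div, Real.log_inv] at hL ⊢
  nlinarith [mul_nonneg (sub_nonneg.2 (pow_le_pow_left₀ hs.le hsr 2)) (sub_nonneg.2 hL)]

/-- A first-order expansion with error `C |z - x|² log (1/|z - x|)` has error at most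
`C r² log (1/r)` throughout the closed ball of radius `r ≤ 1/2`. -/
theorem abs_taylor_error_le_of_norm_sub_le {E : Type*} [NormedAddCommGroup E]
    [InnerProductSpace ℝ E] {C r : ℝ} (hC : 0 < C) (hr0 : 0 < r) (hr : r ≤ 1 / 2)
    {φ : E → ℝ} {x p : E}
    (h : ∀ z : E, z ≠ x → ‖z - x‖ ≤ 1 / 2 →
      |φ z - φ x - ⟪p, z - x⟫| ≤ C * ‖z - x‖ ^ 2 * Real.log (1 / ‖z - x‖))
    {z : E} (hz : ‖z - x‖ ≤ r) :
    |φ z - φ x - ⟪p, z - x⟫| ≤ C * (r ^ 2 * Real.log (1 / r)) := by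
  rcases eq_or_ne z x with rfl | hne
  · have : 0 ≤ Real.log (1 / r) := Real.log_nonneg ((le_div_iff₀ hr0).2 (by linarith))
    simpa using (by positivity : 0 ≤ C * (r ^ 2 * Real.log (1 / r)))
  · refine (h z hne (hz.trans hr)).trans ?_
    rw [mul_assoc]
    exact mul_le_mul_of_nonneg_left
      (sq_mul_log_one_div_le (norm_pos_iff.2 (sub_ne_zero.2 hne)) hz hr) hC.le

/-- If at every point `x` of a set `S`, `φ` is differentiable and is
pinched, up to an error `C |z−x|² log(1/|z−x|)`, by its first-order Taylor expansion,
then the gradient of `φ` is log-Lipschitz on `S`, with a constant `C'` depending only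
on `C`. -/
theorem logLipschitz_gradient_of_two_sided_tangency (C : ℝ) (hC : 0 < C) :
    ∃ C' : ℝ, 0 < C' ∧
      ∀ (d : ℕ), 1 ≤ d →
      ∀ (φ : EuclideanSpace ℝ (Fin d) → ℝ) (S : Set (EuclideanSpace ℝ (Fin d))),
        (∀ x ∈ S, DifferentiableAt ℝ φ x ∧
          ∀ z : EuclideanSpace ℝ (Fin d), z ≠ x → ‖z - x‖ ≤ 1 / 2 →
            |φ z - φ x - ⟪gradient φ x, z - x⟫| ≤
              C * ‖z - x‖ ^ 2 * Real.log (1 / ‖z - x‖)) →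
        ∀ x ∈ S, ∀ y ∈ S, x ≠ y → ‖x - y‖ ≤ 1 / 2 →
          ‖gradient φ x - gradient φ y‖ ≤ C' * ‖x - y‖ * Real.log (1 / ‖x - y‖) := by
  refine ⟨4 * C, by positivity, ?_⟩
  intro d _ φ S hS x hx y hy hxy hr
  have hr0 : 0 < ‖x - y‖ := norm_pos_iff.2 (sub_ne_zero.2 hxy)
  have hX := fun z => abs_taylor_error_le_of_norm_sub_le hC hr0 hr (hS x hx).2 (z := z)
  have hY := fun z => abs_taylor_error_le_of_norm_sub_le hC hr0 hr (hS y hy).2 (z := z)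
  generalize gradient φ x = p at hX ⊢
  generalize gradient φ y = q at hY ⊢
  set r := ‖x - y‖ with hrdef
  obtain ⟨e, he, hwe⟩ : ∃ e, ‖e‖ ≤ 1 ∧ ⟪p - q, e⟫ = ‖p - q‖ := by
    rcases eq_or_ne (p - q) 0 with hw | hw
    · exact ⟨0, by simp, by simp [hw]⟩
    · refine ⟨‖p - q‖⁻¹ • (p - q), (norm_smul_inv_norm (𝕜 := ℝ) hw).le, ?_⟩
      rw [real_inner_smul_right, real_inner_self_eq_norm_sq]
      field_simp [norm_ne_zero_iff.2 hw]
  have hnear : ∀ a b : ℝ, |a| ≤ 1 / 2 → |b| ≤ r / 2 → ‖a • (x - y) + b • e‖ ≤ r := by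
    intro a b ha hb
    refine (norm_add_le _ _).trans ?_
    rw [norm_smul, norm_smul, Real.norm_eq_abs, Real.norm_eq_abs, ← hrdef]
    nlinarith [mul_le_mul_of_nonneg_right ha hr0.le,
      mul_le_mul hb he (norm_nonneg e) (by positivity)]
  have hdiff : ∀ b : ℝ, |b| ≤ r / 2 →
      |φ y - φ x - ⟪p, (-(1 / 2) : ℝ) • (x - y) + b • e⟫
        + ⟪q, (1 / 2 : ℝ) • (x - y) + b • e⟫| ≤ 2 * (C * (r ^ 2 * Real.log (1 / r))) := by
    intro b hb
    set z := (1 / 2 : ℝ) • (x + y) + b • e with hz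
    have hzx : z - x = (-(1 / 2) : ℝ) • (x - y) + b • e := by rw [hz]; module
    have hzy : z - y = (1 / 2 : ℝ) • (x - y) + b • e := by rw [hz]; module
    have h1 := hX z (hzx ▸ hnear _ b (by norm_num [abs_of_pos]) hb)
    have h2 := hY z (hzy ▸ hnear _ b (by norm_num [abs_of_pos]) hb)
    rw [← hzx, ← hzy]
    rw [abs_le] at h1 h2 ⊢
    constructor <;> linarith
  have hplus := hdiff (r / 2) (abs_of_pos (by positivity)).le
  have hminus := hdiff (-(r / 2)) (by rw [abs_neg, abs_of_pos (by positivity)])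
  simp only [inner_add_right, real_inner_smul_right] at hplus hminus
  rw [abs_le] at hplus hminus
  rw [inner_sub_left] at hwe
  have hkey : r * ‖p - q‖ ≤ r * (4 * C * r * Real.log (1 / r)) := by
    rw [← hwe]
    linarith [hplus.1, hminus.2]
  exact le_of_mul_le_mul_left hkey hr0
end
end

section
/- Let T > 0, C > 0 and let N be a positive integer with N ≥ 4T/C. Let (X_n)_{0 ≤ n ≤ N} be a real sequence such that X_{n+1} ≤ X_n + (T/N)(1 − X_n²/C²) for all 0 ≤ n ≤ N−1. Then for every 1 ≤ n ≤ N, X_n ≤ C + C²/t_n, where t_n = nT/N. (Discrete Riccati-type comparison giving the Oleinik-type bound on the divergence of the velocity.) -/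
/-- The logistic step `y ↦ y + k (1 - y²)` never exceeds its value at the vertex `1 / (2k)`. -/
lemma logistic_step_le_vertex {k : ℝ} (hk : 0 < k) (y : ℝ) :
    y + k * (1 - y ^ 2) ≤ k + 1 / (4 * k) := by
  have h : k + 1 / (4 * k) - (y + k * (1 - y ^ 2)) = (2 * k * y - 1) ^ 2 / (4 * k) := by
    field_simp
    ring
  have : 0 ≤ (2 * k * y - 1) ^ 2 / (4 * k) := by positivity
  linarith

/-- The logistic step is monotone to the left of its vertex. -/
lemma logistic_step_mono {k y b : ℝ} (hk : 0 < k) (hyb : y ≤ b) (hb : 2 * k * b ≤ 1) :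
    y + k * (1 - y ^ 2) ≤ b + k * (1 - b ^ 2) := by
  have : 0 ≤ (b - y) * (1 - k * (b + y)) := by
    apply mul_nonneg <;> nlinarith
  nlinarith

/-- The barrier `1 + 1 / (x k)` is a supersolution of the logistic recursion. -/
lemma logistic_step_barrier_le {k x : ℝ} (hk : 0 < k) (hx : 0 < x) :
    (1 + 1 / (x * k)) + k * (1 - (1 + 1 / (x * k)) ^ 2) ≤ 1 + 1 / ((x + 1) * k) := by
  have h : 1 + 1 / ((x + 1) * k) - ((1 + 1 / (x * k)) + k * (1 - (1 + 1 / (x * k)) ^ 2))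
      = 2 / x + 1 / (x ^ 2 * (x + 1) * k) := by
    field_simp
    ring
  have : 0 ≤ 2 / x + 1 / (x ^ 2 * (x + 1) * k) := by positivity
  linarith

/-- Normalized form of the discrete Riccati comparison. -/
lemma logistic_recursion_bound {k : ℝ} (hk : 0 < k) (hk4 : k ≤ 1 / 4) {N : ℕ} {Y : ℕ → ℝ}
    (hY : ∀ n : ℕ, n + 1 ≤ N → Y (n + 1) ≤ Y n + k * (1 - Y n ^ 2)) (n : ℕ) (hn : 1 ≤ n)
    (hnN : n ≤ N) : Y n ≤ 1 + 1 / (n * k) := by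
  induction n, hn using Nat.le_induction with
  | base =>
    have h := (hY 0 hnN).trans (logistic_step_le_vertex hk (Y 0))
    have : 1 / (4 * k) ≤ 1 / (((1 : ℕ) : ℝ) * k) := by
      gcongr
      norm_num
    simp only [zero_add] at h
    linarith
  | succ n hn ih =>
    have ih := ih (by omega)
    have hn0 : (0 : ℝ) < n := by exact_mod_cast hn
    push_cast
    rcases le_or_gt 4 n with h4 | h4
    · have h4' : (4 : ℝ) ≤ n := by exact_mod_cast h4
      refine (hY n hnN).trans
        ((logistic_step_mono hk ih ?_).trans (logistic_step_barrier_le hk hn0))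
      have h : 2 * k * (1 + 1 / (n * k)) = 2 * k + 2 / n := by field_simp
      have : (2 : ℝ) / n ≤ 2 / 4 := by gcongr
      linarith
    · have h4' : (n : ℝ) + 1 ≤ 4 := by exact_mod_cast h4
      have h := (hY n hnN).trans (logistic_step_le_vertex hk (Y n))
      have : 1 / (4 * k) ≤ 1 / (((n : ℝ) + 1) * k) := by gcongr
      linarith

/-- Discrete Riccati-type comparison: if `X_{n+1} ≤ X_n + (T/N)(1 − X_n²/C²)`
for `0 ≤ n ≤ N−1`, with `N ≥ 4T/C`, then `X_n ≤ C + C²/t_n` for `1 ≤ n ≤ N`,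
where `t_n = nT/N`. -/
theorem discrete_riccati_bound (T C : ℝ) (hT : 0 < T) (hC : 0 < C) (N : ℕ) (hN : 0 < N)
    (hNC : 4 * T / C ≤ (N : ℝ)) (X : ℕ → ℝ)
    (hX : ∀ n : ℕ, n + 1 ≤ N → X (n + 1) ≤ X n + (T / N) * (1 - (X n) ^ 2 / C ^ 2)) :
    ∀ n : ℕ, 1 ≤ n → n ≤ N → X n ≤ C + C ^ 2 / ((n : ℝ) * T / N) := by
  intro n hn hnN
  have hN0 : (0 : ℝ) < N := by exact_mod_cast hN
  have hn0 : (0 : ℝ) < n := by exact_mod_cast hn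
  have hk : 0 < T / N / C := by positivity
  have hk4 : T / N / C ≤ 1 / 4 := by
    rw [div_le_iff₀ hC] at hNC
    rw [div_div, div_le_iff₀ (by positivity)]
    linarith
  have h := logistic_recursion_bound (Y := fun m ↦ X m / C) hk hk4 (fun m hm ↦ by
    have h := div_le_div_of_nonneg_right (hX m hm) hC.le
    calc X (m + 1) / C ≤ _ := h
      _ = _ := by field_simp) n hn hnN
  rw [div_le_iff₀ hC] at h
  calc X n ≤ _ := h
    _ = _ := by field_simp
end
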